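/- arXiv:math/0409070 — 2 statements merged into one kernel-verified Lean document; each statement's English description precedes it below -/
import Mathlib

section
/- The purely predicate fragment of LJ+ is equivalent to LJ: every purely predicate formula derivable in LJ+ is derivable in LJ. -/
/-! Syntax of first-order formulas. Atoms are either propositional symbols
(arity-0) or predicate symbols of arity ≥ 1 applied to variables.
There are no function symbols or object constants: terms are variables (ℕ). -/

inductive Formula : Type
  | prop : ℕ → Formula                      -- propositional symbol
  | pred : ℕ → ℕ → List ℕ → Formula         -- predicate symbol (arity ≥ 1) applied to variables
  | top : Formula
  | bot : Formula
  | and : Formula → Formula → Formula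
  | or : Formula → Formula → Formula
  | imp : Formula → Formula → Formula
  | neg : Formula → Formula
  | all : ℕ → Formula → Formula             -- ∀x A
  | ex : ℕ → Formula → Formula              -- ∃x A
  deriving DecidableEq

namespace Formula

/-- Free variables of a formula. -/
def fv : Formula → Finset ℕ
  | prop _ => ∅
  | pred _ x xs => insert x xs.toFinset
  | top => ∅
  | bot => ∅
  | and A B => fv A ∪ fv B
  | or A B => fv A ∪ fv B
  | imp A B => fv A ∪ fv B
  | neg A => fv A
  | all x A => (fv A).erase x
  | ex x A => (fv A).erase x

/-- All variables occurring in a formula (free or bound, including binders). -/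
def vars : Formula → Finset ℕ
  | prop _ => ∅
  | pred _ x xs => insert x xs.toFinset
  | top => ∅
  | bot => ∅
  | and A B => vars A ∪ vars B
  | or A B => vars A ∪ vars B
  | imp A B => vars A ∪ vars B
  | neg A => vars A
  | all x A => insert x (vars A)
  | ex x A => insert x (vars A)

/-- Binder variables of a formula. -/
def bv : Formula → Finset ℕ
  | prop _ => ∅
  | pred _ _ _ => ∅
  | top => ∅
  | bot => ∅
  | and A B => bv A ∪ bv B
  | or A B => bv A ∪ bv B
  | imp A B => bv A ∪ bv B
  | neg A => bv A
  | all x A => insert x (bv A)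
  | ex x A => insert x (bv A)

/-- `rename a b F` replaces the free occurrences of variable `a` in `F` by variable `b`.
`F.rename a b` plays the role of "F(b)" when `F` is "F(a)". -/
def rename (a b : ℕ) : Formula → Formula
  | prop n => prop n
  | pred n x xs =>
      pred n (if x = a then b else x) (xs.map fun y => if y = a then b else y)
  | top => top
  | bot => bot
  | and A B => and (rename a b A) (rename a b B)
  | or A B => or (rename a b A) (rename a b B)
  | imp A B => imp (rename a b A) (rename a b B)
  | neg A => neg (rename a b A)
  | all x A => if x = a then all x A else all x (rename a b A)
  | ex x A => if x = a then ex x A else ex x (rename a b A)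

/-- A formula is propositional if it is built from propositional symbols (and ⊤, ⊥)
by the propositional connectives only. -/
def Propositional : Formula → Prop
  | prop _ => True
  | pred _ _ _ => False
  | top => True
  | bot => True
  | and A B => Propositional A ∧ Propositional B
  | or A B => Propositional A ∧ Propositional B
  | imp A B => Propositional A ∧ Propositional B
  | neg A => Propositional A
  | all _ _ => False
  | ex _ _ => False

/-- A formula is purely predicate if all its atoms are built from predicate symbols
of arity > 0 (it contains no propositional symbols). -/
def PurelyPredicate : Formula → Prop
  | prop _ => False
  | pred _ _ _ => True
  | top => True
  | bot => True
  | and A B => PurelyPredicate A ∧ PurelyPredicate B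
  | or A B => PurelyPredicate A ∧ PurelyPredicate B
  | imp A B => PurelyPredicate A ∧ PurelyPredicate B
  | neg A => PurelyPredicate A
  | all _ A => PurelyPredicate A
  | ex _ A => PurelyPredicate A

/-- Truth-table evaluation of a propositional formula under assignment `v`. -/
def evalP (v : ℕ → Bool) : Formula → Bool
  | prop n => v n
  | pred _ _ _ => false
  | top => true
  | bot => false
  | and A B => evalP v A && evalP v B
  | or A B => evalP v A || evalP v B
  | imp A B => !evalP v A || evalP v B
  | neg A => !evalP v A
  | all _ _ => false
  | ex _ _ => false

/-- A (propositional) formula is classically valid / derivable in classical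
propositional logic if it is true under every truth-value assignment. -/
def ClassicallyValid (A : Formula) : Prop := ∀ v : ℕ → Bool, evalP v A = true

/-- `substProp R C A` replaces all occurrences of the propositional symbol `R`
in `A` by the formula `C` (written A{R|C} in the paper). -/
def substProp (R : ℕ) (C : Formula) : Formula → Formula
  | prop n => if n = R then C else prop n
  | pred n x xs => pred n x xs
  | top => top
  | bot => bot
  | and A B => and (substProp R C A) (substProp R C B)
  | or A B => or (substProp R C A) (substProp R C B)
  | imp A B => imp (substProp R C A) (substProp R C B)
  | neg A => neg (substProp R C A)
  | all x A => all x (substProp R C A)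
  | ex x A => ex x (substProp R C A)

/-- `polProps b F` is the set of propositional symbols having an occurrence of
polarity `b` in `F` (`true` = positive, `false` = negative); `F` itself is a
positive occurrence, ∨ & quantifiers preserve polarity, ¬ flips it, and
`A ⊃ B` flips the polarity of `A` and preserves that of `B`. -/
def polProps : Bool → Formula → Finset ℕ
  | b, prop n => if b then {n} else ∅
  | _, pred _ _ _ => ∅
  | _, top => ∅
  | _, bot => ∅
  | b, and A B => polProps b A ∪ polProps b B
  | b, or A B => polProps b A ∪ polProps b B
  | b, imp A B => polProps (!b) A ∪ polProps b B
  | b, neg A => polProps (!b) A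
  | b, all _ A => polProps b A
  | b, ex _ A => polProps b A

/-- The propositional symbols occurring in a formula. -/
def propSyms (F : Formula) : Finset ℕ := polProps true F ∪ polProps false F

/-- A formula is unipolar if the occurrences of every propositional symbol in it
are either all positive or all negative. -/
def Unipolar (F : Formula) : Prop :=
  ∀ n : ℕ, ¬ (n ∈ polProps true F ∧ n ∈ polProps false F)

end Formula

/-- A sequent Γ ⊢ Λ: the antecedent is a finite sequence of formulas and the
succedent contains at most one formula. -/
abbrev Sequent := List Formula × Option Formula

/-- Free variables of a list of formulas. -/
def fvList (Γ : List Formula) : Finset ℕ := Γ.foldr (fun A s => A.fv ∪ s) ∅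

/-- Free variables of an optional succedent formula. -/
def fvOpt : Option Formula → Finset ℕ
  | none => ∅
  | some A => A.fv

/-- Inference rules (conclusion, list of premises) of Gentzen-style sequent calculi.
The flag `cut` enables the cut rule, the flag `neut` enables the neutralization
rule (restricted to propositional formulas `N`), and `lem` determines the class of
formulas `A` for which the axiom `⊢ A ∨ ¬A` is available. -/
inductive Rule (cut neut : Bool) (lem : Formula → Prop) : Sequent → List Sequent → Prop
  | ax (A : Formula) : Rule cut neut lem ([A], some A) []
  | topR : Rule cut neut lem ([], some .top) []
  | botL : Rule cut neut lem ([.bot], none) []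
  | thinL (A : Formula) (Γ : List Formula) (Λ : Option Formula) :
      Rule cut neut lem (A :: Γ, Λ) [(Γ, Λ)]
  | thinR (A : Formula) (Γ : List Formula) :
      Rule cut neut lem (Γ, some A) [(Γ, none)]
  | contr (A : Formula) (Γ : List Formula) (Λ : Option Formula) :
      Rule cut neut lem (A :: Γ, Λ) [(A :: A :: Γ, Λ)]
  | exch (Δ Γ : List Formula) (A B : Formula) (Λ : Option Formula) :
      Rule cut neut lem (Δ ++ B :: A :: Γ, Λ) [(Δ ++ A :: B :: Γ, Λ)]
  | cut' (Γ Δ : List Formula) (C : Formula) (Λ : Option Formula) (hc : cut = true) :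
      Rule cut neut lem (Γ ++ Δ, Λ) [(Γ, some C), (C :: Δ, Λ)]
  | andR (Γ : List Formula) (A B : Formula) :
      Rule cut neut lem (Γ, some (A.and B)) [(Γ, some A), (Γ, some B)]
  | andL1 (A B : Formula) (Γ : List Formula) (Λ : Option Formula) :
      Rule cut neut lem (A.and B :: Γ, Λ) [(A :: Γ, Λ)]
  | andL2 (A B : Formula) (Γ : List Formula) (Λ : Option Formula) :
      Rule cut neut lem (A.and B :: Γ, Λ) [(B :: Γ, Λ)]
  | orL (A B : Formula) (Γ : List Formula) (Λ : Option Formula) :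
      Rule cut neut lem (A.or B :: Γ, Λ) [(A :: Γ, Λ), (B :: Γ, Λ)]
  | orR1 (Γ : List Formula) (A B : Formula) :
      Rule cut neut lem (Γ, some (A.or B)) [(Γ, some A)]
  | orR2 (Γ : List Formula) (A B : Formula) :
      Rule cut neut lem (Γ, some (A.or B)) [(Γ, some B)]
  | negR (A : Formula) (Γ : List Formula) :
      Rule cut neut lem (Γ, some A.neg) [(A :: Γ, none)]
  | negL (A : Formula) (Γ : List Formula) :
      Rule cut neut lem (A.neg :: Γ, none) [(Γ, some A)]
  | impR (A B : Formula) (Γ : List Formula) :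
      Rule cut neut lem (Γ, some (A.imp B)) [(A :: Γ, some B)]
  | impL (A B : Formula) (Γ Δ : List Formula) (Λ : Option Formula) :
      Rule cut neut lem (A.imp B :: (Γ ++ Δ), Λ) [(Γ, some A), (B :: Δ, Λ)]
  | allR (Γ : List Formula) (x a : ℕ) (G : Formula)
      (ha : a ∉ fvList Γ ∪ (Formula.all x G).fv) (hv : a ∉ G.vars) :
      Rule cut neut lem (Γ, some (.all x G)) [(Γ, some (G.rename x a))]
  | allL (x : ℕ) (G : Formula) (a : ℕ) (Γ : List Formula) (Λ : Option Formula)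
      (hc : a = x ∨ a ∉ G.bv) :
      Rule cut neut lem (.all x G :: Γ, Λ) [(G.rename x a :: Γ, Λ)]
  | exR (Γ : List Formula) (x : ℕ) (G : Formula) (a : ℕ)
      (hc : a = x ∨ a ∉ G.bv) :
      Rule cut neut lem (Γ, some (.ex x G)) [(Γ, some (G.rename x a))]
  | exL (x : ℕ) (G : Formula) (a : ℕ) (Γ : List Formula) (Λ : Option Formula)
      (ha : a ∉ (fvList Γ ∪ (Formula.ex x G).fv) ∪ fvOpt Λ) (hv : a ∉ G.vars) :
      Rule cut neut lem (.ex x G :: Γ, Λ) [(G.rename x a :: Γ, Λ)]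
  | neut' (N : Formula) (Γ : List Formula) (Λ : Option Formula)
      (hn : neut = true) (hN : N.Propositional) :
      Rule cut neut lem (Γ, Λ) [(N :: Γ, Λ), (N.neg :: Γ, Λ)]
  | lemAx (A : Formula) (h : lem A) :
      Rule cut neut lem ([], some (A.or A.neg)) []

/-- Derivability from a set of rules. -/
inductive Derives (R : Sequent → List Sequent → Prop) : Sequent → Prop
  | step {s : Sequent} {ps : List Sequent} :
      R s ps → (∀ p ∈ ps, Derives R p) → Derives R s

/-- No additional excluded-middle axioms. -/
def NoLem : Formula → Prop := fun _ => False

/-- LJ: Gentzen's intuitionistic sequent calculus. -/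
def LJ : Sequent → Prop := Derives (Rule true false NoLem)

/-- LJ+: LJ extended with the neutralization rule. -/
def LJPlus : Sequent → Prop := Derives (Rule true true NoLem)

/-- Cut-free LJ+. -/
def LJPlusCF : Sequent → Prop := Derives (Rule false true NoLem)

/-- LJ extended with the axiom schema ⊢ A ∨ ¬A for every propositional symbol A. -/
def LJLemPropAtoms : Sequent → Prop :=
  Derives (Rule true false (fun A => ∃ n : ℕ, A = Formula.prop n))

/-- LK: Gentzen's classical sequent calculus, presented equivalently as
LJ plus the axiom schema ⊢ A ∨ ¬A for arbitrary formulas A. -/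
def LK : Sequent → Prop := Derives (Rule true false (fun _ => True))

/-- A formula is a theorem of LJ+ if the sequent ⊢ F is derivable. -/
def LJPlusThm (F : Formula) : Prop := LJPlus ([], some F)

def LJThm (F : Formula) : Prop := LJ ([], some F)

def LKThm (F : Formula) : Prop := LK ([], some F)

/-- Intuitionistic Kripke structures: a partially ordered set of nodes with
monotone nonempty domains and monotone valuations for propositional symbols
and for predicate symbols. -/
structure Kripke where
  W : Type
  U : Type
  le : W → W → Prop
  le_refl : ∀ w, le w w
  le_trans : ∀ u v w, le u v → le v w → le u w
  le_antisymm : ∀ u v, le u v → le v u → u = v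
  D : W → Set U
  D_ne : ∀ w, (D w).Nonempty
  D_mono : ∀ {w w'}, le w w' → D w ⊆ D w'
  TP : W → ℕ → Prop
  TQ : W → ℕ → List U → Prop
  TP_mono : ∀ {w w'}, le w w' → ∀ n, TP w n → TP w' n
  TQ_mono : ∀ {w w'}, le w w' → ∀ n ds, TQ w n ds → TQ w' n ds

/-- A constrained Kripke structure: for all nodes k ≤ k' and every propositional
symbol Q, Q is in the valuation of k if and only if it is in the valuation of k'. -/
def Kripke.Constrained (K : Kripke) : Prop :=
  ∀ {w w' : K.W}, K.le w w' → ∀ n : ℕ, (K.TP w n ↔ K.TP w' n)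

/-- The standard intuitionistic forcing relation (with an assignment σ of
domain elements to variables). -/
def Kripke.forces (K : Kripke) : K.W → (ℕ → K.U) → Formula → Prop
  | w, _, .prop n => K.TP w n
  | w, σ, .pred n x xs => K.TQ w n ((x :: xs).map σ)
  | _, _, .top => True
  | _, _, .bot => False
  | w, σ, .and A B => K.forces w σ A ∧ K.forces w σ B
  | w, σ, .or A B => K.forces w σ A ∨ K.forces w σ B
  | w, σ, .imp A B => ∀ w', K.le w w' → K.forces w' σ A → K.forces w' σ B
  | w, σ, .neg A => ∀ w', K.le w w' → ¬ K.forces w' σ A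
  | w, σ, .all x A => ∀ w', K.le w w' → ∀ d ∈ K.D w', K.forces w' (Function.update σ x d) A
  | w, σ, .ex x A => ∃ d ∈ K.D w, K.forces w (Function.update σ x d) A

/-- Validity of a sequent with respect to constrained Kripke structures:
at every node of every constrained Kripke structure (under every assignment into
the node's domain), either some antecedent formula is not forced, or the
succedent is nonempty and its formula is forced. -/
def SeqValid (s : Sequent) : Prop :=
  ∀ K : Kripke, K.Constrained → ∀ w : K.W, ∀ σ : ℕ → K.U, (∀ n, σ n ∈ K.D w) →
    (∃ A ∈ s.1, ¬ K.forces w σ A) ∨ (∃ A, s.2 = some A ∧ K.forces w σ A)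

namespace Formula

/-- Replace every propositional symbol by `⊤`. -/
def trivialize : Formula → Formula
  | prop _ => top
  | pred n x xs => pred n x xs
  | top => top
  | bot => bot
  | and A B => and (trivialize A) (trivialize B)
  | or A B => or (trivialize A) (trivialize B)
  | imp A B => imp (trivialize A) (trivialize B)
  | neg A => neg (trivialize A)
  | all x A => all x (trivialize A)
  | ex x A => ex x (trivialize A)

@[simp] theorem fv_trivialize (A : Formula) : A.trivialize.fv = A.fv := by
  induction A <;> simp_all [trivialize, fv]

@[simp] theorem vars_trivialize (A : Formula) : A.trivialize.vars = A.vars := by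
  induction A <;> simp_all [trivialize, vars]

@[simp] theorem bv_trivialize (A : Formula) : A.trivialize.bv = A.bv := by
  induction A <;> simp_all [trivialize, bv]

theorem trivialize_rename (a b : ℕ) (A : Formula) :
    (A.rename a b).trivialize = A.trivialize.rename a b := by
  induction A <;> simp_all [trivialize, rename] <;> split_ifs <;> simp_all [trivialize]

theorem PurelyPredicate.trivialize_eq {A : Formula} (h : A.PurelyPredicate) :
    A.trivialize = A := by
  induction A <;> simp_all [trivialize, PurelyPredicate]

end Formula

@[simp] theorem fvList_map_trivialize (Γ : List Formula) :
    fvList (Γ.map Formula.trivialize) = fvList Γ := by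
  induction Γ <;> simp_all [fvList]

@[simp] theorem fvOpt_map_trivialize (Λ : Option Formula) :
    fvOpt (Λ.map Formula.trivialize) = fvOpt Λ := by
  cases Λ <;> simp [fvOpt]

section Derives

variable {R : Sequent → List Sequent → Prop} {s p q : Sequent}

theorem Derives.of_nullary_rule (h : R s []) : Derives R s :=
  .step h (by simp)

theorem Derives.of_unary_rule (h : R s [p]) (hp : Derives R p) : Derives R s :=
  .step h (by simpa using hp)

theorem Derives.of_binary_rule (h : R s [p, q]) (hp : Derives R p) (hq : Derives R q) :
    Derives R s :=
  .step h (by simpa using ⟨hp, hq⟩)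

end Derives

open Derives in
/-- `LJ` decides the trivialization of every propositional formula. -/
theorem Formula.Propositional.decided {N : Formula} (hN : N.Propositional) :
    LJ ([], some N.trivialize) ∨ LJ ([N.trivialize], none) := by
  induction N with
  | prop n => exact .inl (of_nullary_rule .topR)
  | top => exact .inl (of_nullary_rule .topR)
  | bot => exact .inr (of_nullary_rule .botL)
  | pred => exact hN.elim
  | all => exact hN.elim
  | ex => exact hN.elim
  | and A B ihA ihB =>
    rcases ihA hN.1 with hA | hA
    · rcases ihB hN.2 with hB | hB
      · exact .inl (of_binary_rule (.andR ..) hA hB)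
      · exact .inr (of_unary_rule (.andL2 ..) hB)
    · exact .inr (of_unary_rule (.andL1 ..) hA)
  | or A B ihA ihB =>
    rcases ihA hN.1 with hA | hA
    · exact .inl (of_unary_rule (.orR1 ..) hA)
    · rcases ihB hN.2 with hB | hB
      · exact .inl (of_unary_rule (.orR2 ..) hB)
      · exact .inr (of_binary_rule (.orL ..) hA hB)
  | imp A B ihA ihB =>
    rcases ihA hN.1 with hA | hA
    · rcases ihB hN.2 with hB | hB
      · exact .inl (of_unary_rule (.impR ..) (of_unary_rule (.thinL ..) hB))
      · exact .inr (of_binary_rule (.impL _ _ [] [] _) hA hB)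
    · exact .inl (of_unary_rule (.impR ..) (of_unary_rule (.thinR ..) hA))
  | neg A ih =>
    rcases ih hN with hA | hA
    · exact .inr (of_unary_rule (.negL ..) hA)
    · exact .inl (of_unary_rule (.negR ..) hA)

open Derives in
/-- Trivializing every formula turns `LJ+` derivations into `LJ` derivations. -/
theorem LJPlus.trivialize {s : Sequent} (h : LJPlus s) :
    LJ (s.1.map Formula.trivialize, s.2.map Formula.trivialize) := by
  induction h with
  | step hr _ ih =>
    cases hr <;>
      simp only [List.mem_cons, List.not_mem_nil, or_false, forall_eq_or_imp, forall_eq,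
        List.map_cons, List.map_nil, List.map_append, Option.map_some, Option.map_none,
        Formula.trivialize, Formula.trivialize_rename] at ih ⊢
    case ax => exact of_nullary_rule (.ax _)
    case topR => exact of_nullary_rule .topR
    case botL => exact of_nullary_rule .botL
    case thinL => exact of_unary_rule (.thinL ..) ih
    case thinR => exact of_unary_rule (.thinR ..) ih
    case contr => exact of_unary_rule (.contr ..) ih
    case exch => exact of_unary_rule (.exch ..) ih
    case cut' => exact of_binary_rule (.cut' _ _ _ _ rfl) ih.1 ih.2
    case andR => exact of_binary_rule (.andR ..) ih.1 ih.2
    case andL1 => exact of_unary_rule (.andL1 ..) ih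
    case andL2 => exact of_unary_rule (.andL2 ..) ih
    case orL => exact of_binary_rule (.orL ..) ih.1 ih.2
    case orR1 => exact of_unary_rule (.orR1 ..) ih
    case orR2 => exact of_unary_rule (.orR2 ..) ih
    case negR => exact of_unary_rule (.negR ..) ih
    case negL => exact of_unary_rule (.negL ..) ih
    case impR => exact of_unary_rule (.impR ..) ih
    case impL => exact of_binary_rule (.impL ..) ih.1 ih.2
    case allR ha hv _ =>
      exact of_unary_rule (.allR _ _ _ _ (by simpa [Formula.fv] using ha) (by simpa using hv)) ih
    case allL hc _ => exact of_unary_rule (.allL _ _ _ _ _ (by simpa using hc)) ih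
    case exR hc _ => exact of_unary_rule (.exR _ _ _ _ (by simpa using hc)) ih
    case exL ha hv _ =>
      exact of_unary_rule
        (.exL _ _ _ _ _ (by simpa [Formula.fv] using ha) (by simpa using hv)) ih
    case neut' _ hN _ =>
      rcases hN.decided with h | h
      · exact of_binary_rule (.cut' [] _ _ _ rfl) h ih.1
      · exact of_binary_rule (.cut' [] _ _ _ rfl) (of_unary_rule (.negR ..) h) ih.2
    case lemAx h _ => exact h.elim

/-- the purely predicate fragment of LJ+ is equivalent to LJ:
every purely predicate formula derivable in LJ+ is derivable in LJ. -/
theorem ljplus_purely_predicate_fragment (F : Formula)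
    (hF : F.PurelyPredicate) (h : LJPlusThm F) : LJThm F := by
  simpa [LJThm, hF.trivialize_eq] using LJPlus.trivialize h
end

section
/- Let A be a purely predicate formula that is classically provable but not derivable in LJ+, let B be a strictly positive subformula occurrence in A, let C be a propositional formula not derivable in LJ+, and let D be any propositional formula. Then the formula obtained from A by replacing that occurrence of B by B ∨ C is not derivable in LJ+, and the formula obtained from A by replacing that occurrence of B by B & D is not derivable in LJ+. -/
/-- Strictly positive contexts: a hole within a formula lying in the scope of
no connectives other than & and ∨ and of no quantifier. -/
inductive SPos : Type
  | hole : SPos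
  | andl : SPos → Formula → SPos
  | andr : Formula → SPos → SPos
  | orl : SPos → Formula → SPos
  | orr : Formula → SPos → SPos

/-- Filling the hole of a strictly positive context with a formula. -/
def SPos.fill : SPos → Formula → Formula
  | .hole, B => B
  | .andl E D, B => (E.fill B).and D
  | .andr D E, B => D.and (E.fill B)
  | .orl E D, B => (E.fill B).or D
  | .orr D E, B => D.or (E.fill B)

namespace Formula

/-- Simultaneous substitution of the formulas `s n` for the propositional symbols `n`. -/
def bindProps (s : ℕ → Formula) : Formula → Formula
  | prop n => s n
  | pred n x xs => pred n x xs
  | top => top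
  | bot => bot
  | and A B => and (bindProps s A) (bindProps s B)
  | or A B => or (bindProps s A) (bindProps s B)
  | imp A B => imp (bindProps s A) (bindProps s B)
  | neg A => neg (bindProps s A)
  | all x A => all x (bindProps s A)
  | ex x A => ex x (bindProps s A)

theorem bindProps_prop (A : Formula) : A.bindProps prop = A := by
  induction A <;> simp_all [bindProps]

theorem PurelyPredicate.bindProps_eq {A : Formula} (h : A.PurelyPredicate) (s : ℕ → Formula) :
    A.bindProps s = A := by
  induction A <;> simp_all [bindProps, PurelyPredicate]

theorem Propositional.fv_eq_empty {A : Formula} (h : A.Propositional) : A.fv = ∅ := by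
  induction A <;> simp_all [fv, Propositional]

theorem Propositional.vars_eq_empty {A : Formula} (h : A.Propositional) : A.vars = ∅ := by
  induction A <;> simp_all [vars, Propositional]

theorem Propositional.bv_eq_empty {A : Formula} (h : A.Propositional) : A.bv = ∅ := by
  induction A <;> simp_all [bv, Propositional]

theorem Propositional.rename_eq {A : Formula} (h : A.Propositional) (a b : ℕ) :
    A.rename a b = A := by
  induction A <;> simp_all [rename, Propositional]

theorem fv_bindProps {s : ℕ → Formula} (hs : ∀ n, (s n).Propositional)
    (A : Formula) : (A.bindProps s).fv = A.fv := by
  induction A <;> simp_all [bindProps, fv, fun n => (hs n).fv_eq_empty]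

theorem vars_bindProps {s : ℕ → Formula} (hs : ∀ n, (s n).Propositional)
    (A : Formula) : (A.bindProps s).vars = A.vars := by
  induction A <;> simp_all [bindProps, vars, fun n => (hs n).vars_eq_empty]

theorem bv_bindProps {s : ℕ → Formula} (hs : ∀ n, (s n).Propositional)
    (A : Formula) : (A.bindProps s).bv = A.bv := by
  induction A <;> simp_all [bindProps, bv, fun n => (hs n).bv_eq_empty]

theorem bindProps_rename {s : ℕ → Formula} (hs : ∀ n, (s n).Propositional)
    (A : Formula) (a b : ℕ) :
    (A.rename a b).bindProps s = (A.bindProps s).rename a b := by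
  induction A with
  | prop n => exact ((hs n).rename_eq a b).symm
  | all x A ih => by_cases h : x = a <;> simp [rename, bindProps, h, ih]
  | ex x A ih => by_cases h : x = a <;> simp [rename, bindProps, h, ih]
  | _ => simp_all [rename, bindProps]

theorem Propositional.bindProps {s : ℕ → Formula} (hs : ∀ n, (s n).Propositional)
    {A : Formula} (h : A.Propositional) :
    (A.bindProps s).Propositional := by
  induction A <;> simp_all [Formula.bindProps, Propositional]

end Formula

theorem fvList_map_bindProps {s : ℕ → Formula} (hs : ∀ n, (s n).Propositional)
    (Γ : List Formula) : fvList (Γ.map (·.bindProps s)) = fvList Γ := by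
  induction Γ with
  | nil => rfl
  | cons A Γ ih => simp_all [fvList, Formula.fv_bindProps hs]

theorem fvOpt_map_bindProps {s : ℕ → Formula} (hs : ∀ n, (s n).Propositional)
    (Λ : Option Formula) : fvOpt (Λ.map (·.bindProps s)) = fvOpt Λ := by
  cases Λ <;> simp [fvOpt, Formula.fv_bindProps hs]

/-- Substitution for propositional symbols throughout a sequent. -/
def Sequent.bindProps (s : ℕ → Formula) (S : Sequent) : Sequent :=
  (S.1.map (·.bindProps s), S.2.map (·.bindProps s))

theorem Rule.bindProps {s : ℕ → Formula} (hs : ∀ n, (s n).Propositional) {cut neut : Bool}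
    {S : Sequent} {ps : List Sequent} (h : Rule cut neut NoLem S ps) :
    Rule cut neut NoLem (S.bindProps s) (ps.map (·.bindProps s)) := by
  have hfv := Formula.fv_bindProps hs
  have hvars := Formula.vars_bindProps hs
  have hbv := Formula.bv_bindProps hs
  have hren := Formula.bindProps_rename hs
  have hl := fvList_map_bindProps hs
  have ho := fvOpt_map_bindProps hs
  cases h <;>
    simp only [Sequent.bindProps, List.map_cons, List.map_nil, List.map_append, Option.map_some,
      Option.map_none, Formula.bindProps, hren]
  case ax => exact .ax _
  case topR => exact .topR
  case botL => exact .botL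
  case thinL => exact .thinL _ _ _
  case thinR => exact .thinR _ _
  case contr => exact .contr _ _ _
  case exch => exact .exch _ _ _ _ _
  case cut' hc => exact .cut' _ _ _ _ hc
  case andR => exact .andR _ _ _
  case andL1 => exact .andL1 _ _ _ _
  case andL2 => exact .andL2 _ _ _ _
  case orL => exact .orL _ _ _ _
  case orR1 => exact .orR1 _ _ _
  case orR2 => exact .orR2 _ _ _
  case negR => exact .negR _ _
  case negL => exact .negL _ _
  case impR => exact .impR _ _ _
  case impL => exact .impL _ _ _ _ _
  case allR ha hv =>
    exact .allR _ _ _ _ (by simpa [Formula.fv, hfv, hl] using ha) (by rwa [hvars])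
  case allL hc => exact .allL _ _ _ _ _ (by rwa [hbv])
  case exR hc => exact .exR _ _ _ _ (by rwa [hbv])
  case exL ha hv =>
    exact .exL _ _ _ _ _ (by simpa [Formula.fv, hfv, hl, ho] using ha) (by rwa [hvars])
  case neut' N hn hN => exact .neut' _ _ _ hn (hN.bindProps hs)
  case lemAx h => exact h.elim

namespace LJPlus

theorem bindProps {s : ℕ → Formula} (hs : ∀ n, (s n).Propositional) {S : Sequent}
    (h : LJPlus S) : LJPlus (S.bindProps s) := by
  induction h with
  | step hr _ ih =>
    refine .step (hr.bindProps hs) fun p hp => ?_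
    obtain ⟨q, hq, rfl⟩ := List.mem_map.1 hp
    exact ih q hq

theorem of_rule₀ {S : Sequent} (hr : Rule true true NoLem S []) : LJPlus S :=
  .step hr (by simp)

theorem of_rule₁ {S P : Sequent} (hr : Rule true true NoLem S [P]) (h : LJPlus P) : LJPlus S :=
  .step hr (List.forall_mem_singleton.2 h)

theorem of_rule₂ {S P Q : Sequent} (hr : Rule true true NoLem S [P, Q]) (h₁ : LJPlus P)
    (h₂ : LJPlus Q) : LJPlus S :=
  .step hr (List.forall_mem_cons.2 ⟨h₁, List.forall_mem_singleton.2 h₂⟩)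

variable {Γ Δ : List Formula} {Λ : Option Formula} {A B C : Formula}

theorem perm_append (h : Γ.Perm Δ) (Θ : List Formula) (d : LJPlus (Θ ++ Γ, Λ)) :
    LJPlus (Θ ++ Δ, Λ) := by
  induction h generalizing Θ with
  | nil => exact d
  | cons A _ ih => simpa using ih (Θ ++ [A]) (by simpa using d)
  | swap A B Γ => exact of_rule₁ (.exch _ _ _ _ _) d
  | trans _ _ ih₁ ih₂ => exact ih₂ _ (ih₁ _ d)

theorem perm (h : Γ.Perm Δ) (d : LJPlus (Γ, Λ)) : LJPlus (Δ, Λ) :=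
  perm_append h [] d

theorem append_left (d : LJPlus (Γ, Λ)) (Δ : List Formula) : LJPlus (Δ ++ Γ, Λ) := by
  induction Δ with
  | nil => exact d
  | cons A Δ ih => exact of_rule₁ (.thinL _ _ _) ih

theorem of_append_of_subset (h : Γ ⊆ Δ) (d : LJPlus (Γ ++ Δ, Λ)) : LJPlus (Δ, Λ) := by
  induction Γ with
  | nil => exact d
  | cons A Γ ih =>
    obtain ⟨hA, hΓ⟩ := List.cons_subset.1 h
    have hp := List.perm_cons_erase (List.mem_append_right Γ hA)
    exact ih hΓ (perm hp.symm (of_rule₁ (.contr _ _ _) (perm (hp.cons A) d)))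

theorem mono (d : LJPlus (Γ, Λ)) (h : Γ ⊆ Δ) : LJPlus (Δ, Λ) :=
  of_append_of_subset h (perm List.perm_append_comm (append_left d Δ))

theorem of_mem (h : A ∈ Γ) : LJPlus (Γ, some A) :=
  mono (of_rule₀ (.ax A)) (by simpa using h)

theorem cut (d₁ : LJPlus (Γ, some A)) (d₂ : LJPlus (A :: Γ, Λ)) : LJPlus (Γ, Λ) :=
  mono (of_rule₂ (.cut' Γ Γ A Λ rfl) d₁ d₂) (by simp)

theorem negL (d : LJPlus (Γ, some A)) : LJPlus (A.neg :: Γ, none) :=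
  of_rule₁ (.negL _ _) d

theorem orL (d₁ : LJPlus (A :: Γ, Λ)) (d₂ : LJPlus (B :: Γ, Λ)) : LJPlus (A.or B :: Γ, Λ) :=
  of_rule₂ (.orL _ _ _ _) d₁ d₂

theorem impL (d₁ : LJPlus (Γ, some A)) (d₂ : LJPlus (B :: Γ, Λ)) : LJPlus (A.imp B :: Γ, Λ) :=
  mono (of_rule₂ (.impL A B Γ Γ Λ) d₁ d₂) (by simp)

theorem fill (E : SPos) (d : LJPlus ([A], some B)) : LJPlus ([E.fill A], some (E.fill B)) := by
  induction E with
  | hole => exact d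
  | andl E D ih =>
    exact of_rule₂ (.andR _ _ _) (of_rule₁ (.andL1 _ _ _ _) ih)
      (of_rule₁ (.andL2 _ _ _ _) (of_mem (by simp)))
  | andr D E ih =>
    exact of_rule₂ (.andR _ _ _) (of_rule₁ (.andL1 _ _ _ _) (of_mem (by simp)))
      (of_rule₁ (.andL2 _ _ _ _) ih)
  | orl E D ih =>
    exact orL (of_rule₁ (.orR1 _ _ _) ih) (of_rule₁ (.orR2 _ _ _) (of_mem (by simp)))
  | orr D E ih =>
    exact orL (of_rule₁ (.orR1 _ _ _) (of_mem (by simp))) (of_rule₁ (.orR2 _ _ _) ih)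

end LJPlus

/-- `Γ` proves `A` (if `b` is true) or refutes `A` (if `b` is false) in LJ+. -/
def Decides (Γ : List Formula) (b : Bool) (A : Formula) : Prop :=
  if b then LJPlus (Γ, some A) else LJPlus (A :: Γ, none)

open LJPlus in
/-- Kalmár's lemma: the truth value of a propositional formula is provable from the truth
values of finitely many propositional symbols. -/
theorem Formula.Propositional.exists_decides {C : Formula} (h : C.Propositional) :
    ∃ S : Finset ℕ, ∀ (Γ : List Formula) (v : ℕ → Bool) (s : ℕ → Formula),
      (∀ n ∈ S, Decides Γ (v n) (s n)) → Decides Γ (C.evalP v) (C.bindProps s) := by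
  induction C with
  | prop n => exact ⟨{n}, fun Γ v s hs => hs n (by simp)⟩
  | pred => exact h.elim
  | all => exact h.elim
  | ex => exact h.elim
  | top => exact ⟨∅, fun Γ v s _ => mono (of_rule₀ .topR) (by simp)⟩
  | bot => exact ⟨∅, fun Γ v s _ => mono (of_rule₀ .botL) (List.cons_subset_cons _ (List.nil_subset Γ))⟩
  | neg A ihA =>
    obtain ⟨S, hS⟩ := ihA h
    refine ⟨S, fun Γ v s hs => ?_⟩
    have hA := hS Γ v s hs
    simp only [evalP]
    generalize A.evalP v = a at hA ⊢
    cases a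
    · exact of_rule₁ (.negR _ _) hA
    · exact negL hA
  | and A B ihA ihB =>
    obtain ⟨S, hS⟩ := ihA h.1
    obtain ⟨T, hT⟩ := ihB h.2
    refine ⟨S ∪ T, fun Γ v s hs => ?_⟩
    have hA := hS Γ v s fun n hn => hs n (Finset.mem_union_left _ hn)
    have hB := hT Γ v s fun n hn => hs n (Finset.mem_union_right _ hn)
    simp only [evalP]
    generalize A.evalP v = a at hA ⊢
    generalize B.evalP v = b at hB ⊢
    cases a
    · exact of_rule₁ (.andL1 _ _ _ _) hA
    · cases b
      · exact of_rule₁ (.andL2 _ _ _ _) hB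
      · exact of_rule₂ (.andR _ _ _) hA hB
  | or A B ihA ihB =>
    obtain ⟨S, hS⟩ := ihA h.1
    obtain ⟨T, hT⟩ := ihB h.2
    refine ⟨S ∪ T, fun Γ v s hs => ?_⟩
    have hA := hS Γ v s fun n hn => hs n (Finset.mem_union_left _ hn)
    have hB := hT Γ v s fun n hn => hs n (Finset.mem_union_right _ hn)
    simp only [evalP]
    generalize A.evalP v = a at hA ⊢
    generalize B.evalP v = b at hB ⊢
    cases a
    · cases b
      · exact orL hA hB
      · exact of_rule₁ (.orR2 _ _ _) hB
    · exact of_rule₁ (.orR1 _ _ _) hA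
  | imp A B ihA ihB =>
    obtain ⟨S, hS⟩ := ihA h.1
    obtain ⟨T, hT⟩ := ihB h.2
    refine ⟨S ∪ T, fun Γ v s hs => ?_⟩
    have hA := hS Γ v s fun n hn => hs n (Finset.mem_union_left _ hn)
    have hB := hT Γ v s fun n hn => hs n (Finset.mem_union_right _ hn)
    simp only [evalP]
    generalize A.evalP v = a at hA ⊢
    generalize B.evalP v = b at hB ⊢
    cases a
    · exact of_rule₁ (.impR _ _ _) (of_rule₁ (.thinR _ _) hA)
    · cases b
      · exact impL hA hB
      · exact of_rule₁ (.impR _ _ _) (of_rule₁ (.thinL _ _ _) hB)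

/-- The literal on the propositional symbol `n` that is true under `v`. -/
def Formula.literal (v : ℕ → Bool) (n : ℕ) : Formula :=
  if v n then .prop n else (Formula.prop n).neg

theorem LJPlus.of_forall_literal (L : List ℕ) (hL : L.Nodup) (Γ : List Formula)
    (Λ : Option Formula) (h : ∀ v, LJPlus (L.map (Formula.literal v) ++ Γ, Λ)) :
    LJPlus (Γ, Λ) := by
  induction L with
  | nil => exact h fun _ => true
  | cons n L ih =>
    obtain ⟨hn, hL⟩ := List.nodup_cons.1 hL
    refine ih hL fun v => ?_
    have key (b : Bool) : L.map (Formula.literal (Function.update v n b)) =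
        L.map (Formula.literal v) := by
      refine List.map_congr_left fun m hm => ?_
      have : m ≠ n := fun e => hn (e ▸ hm)
      simp [Formula.literal, this]
    refine of_rule₂ (.neut' (.prop n) _ _ rfl trivial) ?_ ?_
    · simpa [key, Formula.literal] using h (Function.update v n true)
    · simpa [key, Formula.literal] using h (Function.update v n false)

theorem LJPlusThm.of_classicallyValid {C : Formula} (hC : C.Propositional)
    (h : C.ClassicallyValid) : LJPlusThm C := by
  obtain ⟨S, hS⟩ := hC.exists_decides
  refine LJPlus.of_forall_literal S.toList S.nodup_toList _ _ fun v => ?_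
  have := hS (S.toList.map (Formula.literal v) ++ []) v .prop fun n hn => ?_
  · simpa [Decides, h v, Formula.bindProps_prop] using this
  · have hmem : Formula.literal v n ∈ S.toList.map (Formula.literal v) ++ [] := by
      simpa using ⟨n, hn, rfl⟩
    unfold Formula.literal at hmem
    cases hv : v n <;> simp only [hv, if_true, Bool.false_eq_true, if_false] at hmem
    · exact (LJPlus.of_mem (List.mem_cons_of_mem _ hmem)).cut
        (LJPlus.negL (LJPlus.of_mem List.mem_cons_self))
    · exact LJPlus.of_mem hmem

theorem SPos.bindProps_fill_or (E : SPos) {B C : Formula} (h : (E.fill B).PurelyPredicate)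
    (s : ℕ → Formula) :
    (E.fill (B.or C)).bindProps s = E.fill (B.or (C.bindProps s)) := by
  induction E with
  | hole => simp [fill, Formula.bindProps, Formula.PurelyPredicate.bindProps_eq (A := B) h]
  | andl E D ih | orl E D ih =>
    simp [fill, Formula.bindProps, ih h.1, Formula.PurelyPredicate.bindProps_eq h.2]
  | andr D E ih | orr D E ih =>
    simp [fill, Formula.bindProps, ih h.2, Formula.PurelyPredicate.bindProps_eq h.1]

/-- if A = E[B] is a purely predicate formula that is classically
provable but not derivable in LJ+, where the exhibited occurrence of B is
strictly positive, C is a propositional formula not derivable in LJ+, and D is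
any propositional formula, then neither E[B ∨ C] nor E[B & D] is derivable in LJ+. -/
theorem ljplus_strictly_positive_replacement
    (E : SPos) (B C D : Formula)
    (hA : (E.fill B).PurelyPredicate)
    (hLK : LKThm (E.fill B)) (hnot : ¬ LJPlusThm (E.fill B))
    (hC : C.Propositional) (hCn : ¬ LJPlusThm C)
    (hD : D.Propositional) :
    ¬ LJPlusThm (E.fill (B.or C)) ∧ ¬ LJPlusThm (E.fill (B.and D)) := by
  refine ⟨fun h => hnot ?_, fun h => hnot ?_⟩
  · obtain ⟨v, hv⟩ : ∃ v, C.evalP v = false := by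
      by_contra! hv
      exact hCn (.of_classicallyValid hC fun v => by simpa using hv v)
    obtain ⟨S, hS⟩ := hC.exists_decides
    set s : ℕ → Formula := fun n => if v n then .top else .bot with hs
    have hprop (n : ℕ) : (s n).Propositional := by
      cases hn : v n <;> simp [hs, hn, Formula.Propositional]
    have hrefute : LJPlus ([C.bindProps s], none) := by
      have := hS [] v s fun n _ => by
        cases hn : v n
        · simpa [hs, hn, Decides] using LJPlus.of_rule₀ .botL
        · simpa [hs, hn, Decides] using LJPlus.of_rule₀ .topR
      simpa [Decides, hv] using this
    have hsub : LJPlusThm (E.fill (B.or (C.bindProps s))) := by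
      rw [LJPlusThm, ← E.bindProps_fill_or hA]
      exact LJPlus.bindProps hprop h
    exact LJPlus.cut hsub (LJPlus.fill E (LJPlus.orL (LJPlus.of_mem (by simp))
      (LJPlus.of_rule₁ (.thinR _ _) hrefute)))
  · exact LJPlus.cut h (LJPlus.fill E (LJPlus.of_rule₁ (.andL1 _ _ _ _)
      (LJPlus.of_mem (by simp))))
end
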